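/- arXiv:1507.07413 — 2 statements merged into one kernel-verified Lean document; each statement's English description precedes it below -/
import Mathlib

section
/- Let F be a field, let c = (c₁, …, c_l) be a composition of N (each c_i ≥ 1), and let p, q ≥ 1 with p + q = N. Then there exists a permutation matrix w ∈ GL_N(F) such that w U_{p,q} w^{−1} ⊆ U_c^− if and only if q = c₁ + c₂ + … + c_t for some 1 ≤ t ≤ l−1. (This combinatorial criterion is what is verified in the proofs of Lemma 3.2, Lemma 4.1, and Propositions 4.4 and 5.1.) -/
open Matrix

/-- The index (0-based) of the block containing position `i` (0-based), for the
composition `c`. -/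
def blockOf (c : List ℕ) (i : ℕ) : ℕ :=
  (List.range c.length).countP fun t => decide ((c.take (t + 1)).sum ≤ i)

/-- `U_c`: the block upper-triangular unipotent matrices for the composition
`c` of `N` (diagonal blocks identity, zero below the block diagonal). -/
def UComp (c : List ℕ) (N : ℕ) (F : Type*) [Field F] :
    Set (Matrix (Fin N) (Fin N) F) :=
  { M | (∀ i, M i i = 1) ∧
      ∀ i j : Fin N, i ≠ j → blockOf c (j : ℕ) ≤ blockOf c (i : ℕ) → M i j = 0 }

/-- `U_c⁻`: the image of `U_c` under matrix transpose. -/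
def UCompMinus (c : List ℕ) (N : ℕ) (F : Type*) [Field F] :
    Set (Matrix (Fin N) (Fin N) F) :=
  { M | M.transpose ∈ UComp c N F }

/-- The permutation matrix attached to `σ` (a Weyl element of `GL_N`). -/
def permMat (N : ℕ) (F : Type*) [Field F] (σ : Equiv.Perm (Fin N)) :
    Matrix (Fin N) (Fin N) F :=
  fun i j => if σ j = i then 1 else 0

theorem blockOf_eq_card (c : List ℕ) (i : ℕ) :
    blockOf c i =
      ((Finset.range c.length).filter fun t => (c.take (t + 1)).sum ≤ i).card := by
  rw [blockOf, List.countP_eq_length_filter]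
  rfl

/-- A block boundary separates `a` from `b` iff `a` lies in a strictly earlier block. -/
theorem blockOf_lt_iff (c : List ℕ) (a b : ℕ) :
    blockOf c a < blockOf c b ↔
      ∃ t < c.length, a < (c.take (t + 1)).sum ∧ (c.take (t + 1)).sum ≤ b := by
  simp only [blockOf_eq_card]
  constructor
  · intro h
    obtain ⟨t, ht, hta⟩ := Finset.exists_mem_notMem_of_card_lt_card h
    simp only [Finset.mem_filter, Finset.mem_range, not_and, not_le] at ht hta
    exact ⟨t, ht.1, hta ht.1, ht.2⟩
  · rintro ⟨t, ht, hta, htb⟩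
    apply Finset.card_lt_card
    rw [Finset.ssubset_iff_of_subset]
    · exact ⟨t, Finset.mem_filter.2 ⟨Finset.mem_range.2 ht, htb⟩,
        fun h => absurd (Finset.mem_filter.1 h).2 (not_le.2 hta)⟩
    · intro s hs
      simp only [Finset.mem_filter] at hs ⊢
      exact ⟨hs.1, by omega⟩

theorem blockOf_pair_lt_iff {p q i j : ℕ} (hj : j < p + q) :
    blockOf [p, q] i < blockOf [p, q] j ↔ i < p ∧ p ≤ j := by
  rw [blockOf_lt_iff]
  constructor
  · rintro ⟨t, ht, h1, h2⟩
    have ht : t < 2 := ht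
    interval_cases t <;> simp at h1 h2 <;> omega
  · rintro ⟨h1, h2⟩
    exact ⟨0, by simp, by simpa using h1, by simpa using h2⟩

theorem permMat_mul_mul_inv {N : ℕ} {F : Type*} [Field F] (σ : Equiv.Perm (Fin N))
    (M : Matrix (Fin N) (Fin N) F) :
    permMat N F σ * M * (permMat N F σ)⁻¹ = M.submatrix σ.symm σ.symm := by
  have hP : permMat N F σ = (1 : Matrix (Fin N) (Fin N) F).submatrix σ.symm id := by
    ext i j
    simp [permMat, Matrix.one_apply, Equiv.symm_apply_eq, eq_comm (a := i)]
  have hinv : (permMat N F σ)⁻¹ = (1 : Matrix (Fin N) (Fin N) F).submatrix id σ.symm := by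
    apply Matrix.inv_eq_right_inv
    rw [hP, ← Matrix.submatrix_mul _ _ _ _ _ Function.bijective_id]
    simp
  rw [hinv, hP]
  ext i j
  simp [Matrix.mul_apply, Matrix.one_apply]

/-- Conjugation by `σ` carries `U_{p,q}` into `U_c⁻` iff every root of `U_{p,q}` becomes a root
of `U_c⁻`. -/
theorem conj_mem_UCompMinus_iff (F : Type*) [Field F] (c : List ℕ) {N p q : ℕ}
    (hpq : p + q = N) (σ : Equiv.Perm (Fin N)) :
    (∀ M ∈ UComp [p, q] N F,
        permMat N F σ * M * (permMat N F σ)⁻¹ ∈ UCompMinus c N F) ↔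
      ∀ i j : Fin N, (i : ℕ) < p → p ≤ (j : ℕ) →
        blockOf c (σ j : ℕ) < blockOf c (σ i : ℕ) := by
  simp only [permMat_mul_mul_inv]
  constructor
  · intro h i j hi hj
    have hij : i ≠ j := by rintro rfl; omega
    have hM := h (Matrix.of fun a b => if a = b then 1 else if (a : ℕ) < p ∧ p ≤ (b : ℕ) then 1 else 0)
      ⟨by simp, fun a b hab hba => by
        have := (blockOf_pair_lt_iff (p := p) (q := q) (i := a) (j := b)
          (by omega)).not.1 (not_lt.2 hba)
        simp [hab, this]⟩
    by_contra! hle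
    have := hM.2 (σ j) (σ i) (by simpa using hij.symm) hle
    simp [hij, hi, hj] at this
  · rintro h M ⟨hdiag, hoff⟩
    refine ⟨fun i => by simpa using hdiag _, fun i j hij hji => ?_⟩
    refine hoff _ _ (by simpa using hij.symm) ?_
    by_contra! hlt
    rw [blockOf_pair_lt_iff (by omega)] at hlt
    have := h _ _ hlt.1 hlt.2
    simp only [Equiv.apply_symm_apply] at this
    omega

/-- A permutation of `Fin (p + q)` moving the last `q` positions before the first `p` ones
sends the last `q` positions to the initial segment of length `q`. -/
theorem lt_iff_of_perm_swaps {N p q : ℕ} (hpq : p + q = N) (σ : Equiv.Perm (Fin N))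
    (h : ∀ i j : Fin N, (i : ℕ) < p → p ≤ (j : ℕ) → σ j < σ i) (k : Fin N) :
    (σ k : ℕ) < q ↔ p ≤ (k : ℕ) := by
  constructor
  · intro hk
    by_contra! hkp
    have := Finset.card_le_card_of_injOn (s := (Finset.univ : Finset (Fin q)))
      (t := Finset.Iio (σ k)) (fun j => σ ⟨p + j, by omega⟩)
      (fun j _ => by simpa using h k ⟨p + j, by omega⟩ hkp (by simp))
      (fun a _ b _ hab => by simpa [Fin.ext_iff] using hab)
    simp at this
    omega
  · intro hk
    have := Finset.card_le_card_of_injOn (s := (Finset.univ : Finset (Fin p)))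
      (t := Finset.Ioi (σ k)) (fun i => σ ⟨i, by omega⟩)
      (fun i _ => by simpa using h ⟨i, by omega⟩ k i.2 hk)
      (fun a _ b _ hab => by simpa [Fin.ext_iff] using hab)
    simp at this
    omega

/-- The permutation of `Fin N`, for `p + q = N`, exchanging the first `p` positions with the
last `q` ones and preserving the order inside each group. -/
def blockSwap {N p q : ℕ} (hpq : p + q = N) : Equiv.Perm (Fin N) where
  toFun i := if h : (i : ℕ) < p then ⟨i + q, by omega⟩ else ⟨i - p, by omega⟩
  invFun i := if h : (i : ℕ) < q then ⟨i + p, by omega⟩ else ⟨i - q, by omega⟩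
  left_inv i := by
    ext
    by_cases h : (i : ℕ) < p
    · simp [h]
    · have : (i : ℕ) - p < q := by omega
      simp [h, this]
      omega
  right_inv i := by
    ext
    by_cases h : (i : ℕ) < q
    · simp [h]
    · have : (i : ℕ) - q < p := by omega
      simp [h, this]
      omega

/-- There is a permutation matrix `w` with `w U_{p,q} w⁻¹ ⊆ U_c⁻` iff
`q = c₁ + ⋯ + c_t` for some `1 ≤ t ≤ l − 1`. -/
theorem stmt6 (F : Type*) [Field F] (c : List ℕ) (hc : ∀ x ∈ c, 0 < x)
    (N p q : ℕ) (hp : 0 < p) (hq : 0 < q) (hpq : p + q = N)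
    (hsum : c.sum = N) :
    (∃ σ : Equiv.Perm (Fin N),
        ∀ M ∈ UComp [p, q] N F,
          permMat N F σ * M * (permMat N F σ)⁻¹ ∈ UCompMinus c N F) ↔
      ∃ t, 1 ≤ t ∧ t ≤ c.length - 1 ∧ (c.take t).sum = q := by
  simp only [conj_mem_UCompMinus_iff F c hpq]
  constructor
  · rintro ⟨σ, h⟩
    have hlt := lt_iff_of_perm_swaps hpq σ fun i j hi hj => by
      obtain ⟨t, -, h1, h2⟩ := (blockOf_lt_iff _ _ _).1 (h i j hi hj)
      exact Fin.lt_def.2 (by omega)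
    have h1 := hlt (σ.symm ⟨q, by omega⟩)
    have h2 := hlt (σ.symm ⟨q - 1, by omega⟩)
    simp only [Equiv.apply_symm_apply] at h1 h2
    have h3 := h (σ.symm ⟨q, by omega⟩) (σ.symm ⟨q - 1, by omega⟩) (by omega) (by omega)
    simp only [Equiv.apply_symm_apply] at h3
    obtain ⟨t, ht, hta, htb⟩ := (blockOf_lt_iff _ _ _).1 h3
    refine ⟨t + 1, by omega, ?_, by omega⟩
    by_contra! hlen
    rw [List.take_of_length_le (by omega)] at htb
    omega
  · rintro ⟨t, ht, htl, hsum_t⟩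
    refine ⟨blockSwap hpq, fun i j hi hj => (blockOf_lt_iff _ _ _).2 ⟨t - 1, by omega, ?_⟩⟩
    rw [Nat.sub_add_cancel ht, hsum_t]
    simp only [blockSwap, Equiv.coe_fn_mk, hi, not_lt.2 hj, dite_true, dite_false]
    omega
end

section
/- Let F be a field, let n, l ≥ 1, N = ln, and let p, q ≥ 1 with p + q = N. Let c = (n, n, …, n) be the composition of N with l parts equal to n. Then there exists a permutation matrix w ∈ GL_N(F) with w U_{p,q} w^{−1} ⊆ U_c^− if and only if n divides q. (This is the dichotomy used in the proof of Lemma 3.2: the constant term of the residue representation along the unipotent radical U of a maximal parabolic can be nonzero only when U = U_{(l−m)n, mn} for some m.) -/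
open Matrix

theorem blockOf_pair {p q i : ℕ} (hi : i < p + q) :
    blockOf [p, q] i = if p ≤ i then 1 else 0 := by
  have h : ¬ p + q ≤ i := by omega
  by_cases hp : p ≤ i <;> simp [blockOf, List.range_succ, hp, h]

theorem countP_range_lt (k l : ℕ) :
    (List.range l).countP (fun t => decide (t < k)) = min k l := by
  induction l with
  | zero => simp
  | succ l ih =>
    rw [List.range_succ, List.countP_append, ih]
    by_cases h : l < k <;> simp [h] <;> omega

theorem blockOf_replicate {n l i : ℕ} (hn : 0 < n) (hi : i < l * n) :
    blockOf (List.replicate l n) i = i / n := by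
  have hdiv : i / n < l := (Nat.div_lt_iff_lt_mul hn).2 hi
  rw [blockOf, List.length_replicate, ← min_eq_left hdiv.le, ← countP_range_lt]
  refine List.countP_congr fun t ht => ?_
  have ht' : t + 1 ≤ l := List.mem_range.1 ht
  simp only [List.take_replicate, List.sum_replicate, smul_eq_mul, min_eq_left ht',
    decide_eq_true_eq]
  rw [← Nat.le_div_iff_mul_le hn, Nat.succ_le_iff]

theorem permMat_mul_apply {N : ℕ} {F : Type*} [Field F] (σ : Equiv.Perm (Fin N))
    (M : Matrix (Fin N) (Fin N) F) (i j : Fin N) :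
    (permMat N F σ * M) i j = M (σ.symm i) j := by
  simp [Matrix.mul_apply, permMat, ← Equiv.eq_symm_apply]

theorem mul_permMat_apply {N : ℕ} {F : Type*} [Field F] (σ : Equiv.Perm (Fin N))
    (M : Matrix (Fin N) (Fin N) F) (i j : Fin N) :
    (M * permMat N F σ) i j = M i (σ j) := by
  simp [Matrix.mul_apply, permMat]

theorem permMat_inv {N : ℕ} {F : Type*} [Field F] (σ : Equiv.Perm (Fin N)) :
    (permMat N F σ)⁻¹ = permMat N F σ.symm := by
  refine Matrix.inv_eq_right_inv ?_
  ext i j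
  simp [permMat_mul_apply, permMat, Matrix.one_apply, eq_comm]

theorem permMat_conj_apply {N : ℕ} {F : Type*} [Field F] (σ : Equiv.Perm (Fin N))
    (M : Matrix (Fin N) (Fin N) F) (i j : Fin N) :
    (permMat N F σ * M * (permMat N F σ)⁻¹) i j = M (σ.symm i) (σ.symm j) := by
  rw [permMat_inv, mul_permMat_apply, permMat_mul_apply]

/-- A permutation matrix conjugates `U_c` into `U_d⁻` exactly when the permutation
reverses the strict order of blocks. -/
theorem permMat_conj_mem_UCompMinus_iff {N : ℕ} {F : Type*} [Field F] (c d : List ℕ)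
    (σ : Equiv.Perm (Fin N)) :
    (∀ M ∈ UComp c N F, permMat N F σ * M * (permMat N F σ)⁻¹ ∈ UCompMinus d N F) ↔
      ∀ a b : Fin N, blockOf c a < blockOf c b → blockOf d (σ b) < blockOf d (σ a) := by
  constructor
  · intro h a b hab
    have hne : a ≠ b := by
      rintro rfl
      exact lt_irrefl _ hab
    by_contra! hle
    have hM : (1 + Matrix.single a b 1 : Matrix (Fin N) (Fin N) F) ∈ UComp c N F := by
      refine ⟨fun i => ?_, fun i j hij hb => ?_⟩
      · have : ¬ (a = i ∧ b = i) := fun ⟨h₁, h₂⟩ => hne (h₁.trans h₂.symm)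
        simp [this]
      · have : ¬ (a = i ∧ b = j) := by
          rintro ⟨rfl, rfl⟩
          exact absurd hb (not_le.2 hab)
        simp [hij, this]
    have h0 := (h _ hM).2 (σ b) (σ a) (fun e => hne (σ.injective e).symm) hle
    rw [Matrix.transpose_apply, permMat_conj_apply] at h0
    simp [hne] at h0
  · rintro h M ⟨hdiag, hoff⟩
    refine ⟨fun i => ?_, fun i j hij hb => ?_⟩
    · rw [Matrix.transpose_apply, permMat_conj_apply, hdiag]
    · rw [Matrix.transpose_apply, permMat_conj_apply]
      refine hoff _ _ (fun e => hij (σ.symm.injective e).symm) ?_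
      by_contra! hlt
      have := h _ _ hlt
      simp only [Equiv.apply_symm_apply] at this
      omega

/-- If a permutation of `Fin (p + q)` sends the last `q` positions to blocks of size `n`
strictly preceding those of the images of the first `p` positions, then `n ∣ q`. -/
theorem dvd_of_perm_div_lt {n p q : ℕ} (hp : 0 < p) (hq : 0 < q)
    (σ : Equiv.Perm (Fin (p + q)))
    (h : ∀ a b : Fin (p + q), (a : ℕ) < p → p ≤ (b : ℕ) →
      (σ b : ℕ) / n < (σ a : ℕ) / n) : n ∣ q := by
  have hlt : ∀ a b : Fin (p + q), (a : ℕ) < p → p ≤ (b : ℕ) → σ b < σ a := fun a b ha hb =>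
    lt_of_not_ge fun hle => absurd (h a b ha hb) (not_lt.2 (Nat.div_le_div_right hle))
  let pt : Fin (p + q) := ⟨p, by omega⟩
  have hcard : ((Finset.Ici pt).map σ.toEmbedding).card = q := by
    simp [pt]
  have hlast : p ≤ (σ.symm ⟨q - 1, by omega⟩ : ℕ) := by
    by_contra! ha
    have hsub : (Finset.Ici pt).map σ.toEmbedding ⊆ Finset.Iio ⟨q - 1, by omega⟩ := by
      intro x hx
      obtain ⟨b, hb, rfl⟩ := Finset.mem_map.1 hx
      exact Finset.mem_Iio.2 (hlt _ b ha (Fin.le_def.1 (Finset.mem_Ici.1 hb)) |>.trans_eq (by simp))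
    have := Finset.card_le_card hsub
    rw [hcard, Fin.card_Iio] at this
    simp only at this
    omega
  have hfirst : (σ.symm ⟨q, by omega⟩ : ℕ) < p := by
    by_contra! hb
    have hsub : Finset.Iic ⟨q, by omega⟩ ⊆ (Finset.Ici pt).map σ.toEmbedding := by
      intro x hx
      refine Finset.mem_map.2 ⟨σ.symm x, Finset.mem_Ici.2 ?_, by simp⟩
      by_contra! hx'
      have := hlt (σ.symm x) _ hx' hb
      simp only [Equiv.apply_symm_apply] at this
      exact absurd this (not_lt.2 (Finset.mem_Iic.1 hx))
    have := Finset.card_le_card hsub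
    rw [hcard, Fin.card_Iic] at this
    simp only at this
    omega
  have hdiv := h _ _ hfirst hlast
  simp only [Equiv.apply_symm_apply] at hdiv
  obtain ⟨k, rfl⟩ : ∃ k, q = k + 1 := ⟨q - 1, by omega⟩
  by_contra hnd
  simp [Nat.succ_div_of_not_dvd hnd] at hdiv

/-- When `n ∣ q`, swapping the first `p` and the last `q` positions of `Fin (p + q)`
separates them into different blocks of size `n`. -/
theorem exists_perm_div_lt {n p q : ℕ} (hn : 0 < n) (h : n ∣ q) :
    ∃ σ : Equiv.Perm (Fin (p + q)), ∀ a b : Fin (p + q), (a : ℕ) < p → p ≤ (b : ℕ) →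
      (σ b : ℕ) / n < (σ a : ℕ) / n := by
  refine ⟨finAddFlip.trans (finCongr (add_comm q p)), fun a b ha hb => ?_⟩
  have hσa : ((finAddFlip.trans (finCongr (add_comm q p)) a : Fin (p + q)) : ℕ) = q + a := by
    simp [finAddFlip_apply_mk_left ha]
  have hσb : ((finAddFlip.trans (finCongr (add_comm q p)) b : Fin (p + q)) : ℕ) = b - p := by
    simp [finAddFlip_apply_mk_right hb b.2]
  rw [hσa, hσb]
  obtain ⟨m, rfl⟩ := h
  have hb' := b.2
  have hmn := mul_comm m n
  calc ((b : ℕ) - p) / n < m := (Nat.div_lt_iff_lt_mul hn).2 (by omega)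
    _ ≤ (n * m + a) / n := (Nat.le_div_iff_mul_le hn).2 (by omega)

/-- For `N = ln` and `c = (n, …, n)` (`l` parts), there is a permutation
matrix `w` with `w U_{p,q} w⁻¹ ⊆ U_c⁻` iff `n` divides `q`. -/
theorem stmt7 (F : Type*) [Field F] (n l : ℕ) (hn : 0 < n) (hl : 0 < l)
    (N p q : ℕ) (hp : 0 < p) (hq : 0 < q) (hpq : p + q = N)
    (hN : N = l * n) :
    (∃ σ : Equiv.Perm (Fin N),
        ∀ M ∈ UComp [p, q] N F,
          permMat N F σ * M * (permMat N F σ)⁻¹ ∈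
            UCompMinus (List.replicate l n) N F) ↔
      n ∣ q := by
  subst hpq
  have key : ∀ σ : Equiv.Perm (Fin (p + q)),
      (∀ M ∈ UComp [p, q] (p + q) F, permMat (p + q) F σ * M * (permMat (p + q) F σ)⁻¹ ∈
        UCompMinus (List.replicate l n) (p + q) F) ↔
      ∀ a b : Fin (p + q), (a : ℕ) < p → p ≤ (b : ℕ) → (σ b : ℕ) / n < (σ a : ℕ) / n := by
    intro σ
    rw [permMat_conj_mem_UCompMinus_iff]
    refine forall₂_congr fun a b => ?_
    rw [blockOf_pair a.2, blockOf_pair b.2, blockOf_replicate hn (hN ▸ (σ b).2),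
      blockOf_replicate hn (hN ▸ (σ a).2), ← and_imp]
    refine imp_congr_left ?_
    split_ifs <;> simp <;> omega
  simp only [key]
  exact ⟨fun ⟨σ, h⟩ => dvd_of_perm_div_lt hp hq σ h, exists_perm_div_lt hn⟩
end
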